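/- Let $X$ be a real vector space, $D \subseteq X$ a convex set, and $f, g \colon D \to \mathbb{R}$. Suppose that for all $n \in \mathbb{N}$, all $x_0, x_1, \dots, x_n \in D$, all $x \in \operatorname{conv}\{x_1, \dots, x_n\}$, and all $t \in [0,1]$, one has $f((1-t)x_0 + tx) \le (1-t)g(x_0) + t f(x)$. Then there exists a convex function $\varphi \colon D \to \mathbb{R}$ with $f \le \varphi \le g$ on $D$. -/

import Mathlib

/-- If `C` contains `A` and all segments joining points of `A` to points of `C`, then it contains
the convex hull of `A`. -/
theorem convexHull_subset_of_forall_segment_subset {E : Type*} [AddCommGroup E] [Module ℝ E]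
    {A C : Set E} (hAC : A ⊆ C) (h : ∀ a ∈ A, ∀ c ∈ C, segment ℝ a c ⊆ C) :
    convexHull ℝ A ⊆ C := by
  classical
  rw [convexHull_eq_union_convexHull_finite_subsets]
  refine Set.iUnion₂_subset fun s => ?_
  induction s using Finset.induction_on with
  | empty => simp
  | insert a s _ ih =>
    intro hs
    rw [Finset.coe_insert, Set.insert_subset_iff] at hs
    rw [Finset.coe_insert]
    rcases (s : Set E).eq_empty_or_nonempty with he | hne
    · rw [he]
      simpa using hAC hs.1
    · rw [convexHull_insert hne, convexJoin_singleton_left]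
      exact Set.iUnion₂_subset fun c hc => h a hs.1 c (ih hs.2 hc)

/-- The lower envelope of a convex subset of `E × ℝ` is convex wherever its fibres are nonempty and
bounded below. -/
theorem Convex.convexOn_sInf_fiber {E : Type*} [AddCommGroup E] [Module ℝ E]
    {K : Set (E × ℝ)} (hK : Convex ℝ K) {D : Set E} (hD : Convex ℝ D)
    (hne : ∀ x ∈ D, {r | (x, r) ∈ K}.Nonempty) (hbdd : ∀ x ∈ D, BddBelow {r | (x, r) ∈ K}) :
    ConvexOn ℝ D fun x => sInf {r | (x, r) ∈ K} := by
  refine ⟨hD, fun x hx y hy a b ha hb hab => le_of_forall_pos_le_add fun ε hε => ?_⟩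
  obtain ⟨r, hr, hrε⟩ := exists_lt_of_csInf_lt (hne x hx) (lt_add_of_pos_right _ hε)
  obtain ⟨s, hs, hsε⟩ := exists_lt_of_csInf_lt (hne y hy) (lt_add_of_pos_right _ hε)
  have hle : sInf {q | (a • x + b • y, q) ∈ K} ≤ a * r + b * s :=
    csInf_le (hbdd _ (hD hx hy ha hb hab)) (hK hr hs ha hb hab)
  simp only [smul_eq_mul]
  calc _ ≤ a * r + b * s := hle
    _ ≤ a * (sInf {r | (x, r) ∈ K} + ε) + b * (sInf {r | (y, r) ∈ K} + ε) := by gcongr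
    _ = _ := by linear_combination ε * hab

/-- Vector-space specialization of the paper's main separation theorem: if for all points
`x₀, x₁, …, xₙ ∈ D`, all `x ∈ conv {x₁, …, xₙ}` and all `t ∈ [0,1]` we have
`f ((1-t) x₀ + t x) ≤ (1-t) g x₀ + t f x`, then `f` and `g` admit a convex separator on `D`. -/
theorem convex_separation_of_segment_ineq (X : Type*) [AddCommGroup X] [Module ℝ X]
    (D : Set X) (hD : Convex ℝ D) (f g : X → ℝ)
    (h : ∀ (n : ℕ) (x₀ : X), x₀ ∈ D → ∀ xs : Fin n → X, (∀ k, xs k ∈ D) →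
      ∀ x ∈ convexHull ℝ (Set.range xs), ∀ t ∈ Set.Icc (0 : ℝ) 1,
      f ((1 - t) • x₀ + t • x) ≤ (1 - t) * g x₀ + t * f x) :
    ∃ φ : X → ℝ, ConvexOn ℝ D φ ∧ ∀ x ∈ D, f x ≤ φ x ∧ φ x ≤ g x := by
  have segment_ineq : ∀ x₀ ∈ D, ∀ x ∈ D, ∀ a b : ℝ, 0 ≤ a → 0 ≤ b → a + b = 1 →
      f (a • x₀ + b • x) ≤ a * g x₀ + b * f x := by
    intro x₀ hx₀ x hx a b ha hb hab
    obtain rfl : a = 1 - b := by linarith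
    exact h 1 x₀ hx₀ (fun _ => x) (fun _ => hx) x (subset_convexHull ℝ _ ⟨0, rfl⟩) b
      ⟨hb, by linarith⟩
  have hfg : ∀ x ∈ D, f x ≤ g x := fun x hx => by
    simpa using segment_ineq x hx x hx 1 0 zero_le_one le_rfl (add_zero 1)
  set K := convexHull ℝ {p : X × ℝ | p.1 ∈ D ∧ g p.1 ≤ p.2}
  have hgK : ∀ x ∈ D, (x, g x) ∈ K := fun x hx => subset_convexHull ℝ _ ⟨hx, le_rfl⟩
  have hKf : K ⊆ {p : X × ℝ | p.1 ∈ D ∧ f p.1 ≤ p.2} := by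
    refine convexHull_subset_of_forall_segment_subset
      (fun p hp => ⟨hp.1, (hfg _ hp.1).trans hp.2⟩) ?_
    rintro ⟨x, r⟩ ⟨hx, hr⟩ ⟨y, s⟩ ⟨hy, hs⟩ _ ⟨a, b, ha, hb, hab, rfl⟩
    refine ⟨hD hx hy ha hb hab, (segment_ineq x hx y hy a b ha hb hab).trans ?_⟩
    exact add_le_add (mul_le_mul_of_nonneg_left hr ha) (mul_le_mul_of_nonneg_left hs hb)
  have hbdd : ∀ x ∈ D, BddBelow {r | (x, r) ∈ K} := fun x _ => ⟨f x, fun r hr => (hKf hr).2⟩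
  exact ⟨fun x => sInf {r | (x, r) ∈ K},
    (convex_convexHull ℝ _).convexOn_sInf_fiber hD (fun x hx => ⟨g x, hgK x hx⟩) hbdd,
    fun x hx => ⟨le_csInf ⟨g x, hgK x hx⟩ fun r hr => (hKf hr).2, csInf_le (hbdd x hx) (hgK x hx)⟩⟩
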